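/- arXiv:2009.00122 — 4 statements merged into one kernel-verified Lean document; each statement's English description precedes it below -/
import Mathlib

section
/- Let π be a permutation of [n] and τ a permutation of [k]. Then π contains τ (as a permutation pattern) if and only if the set partition s(π) of [2n] contains the set partition s(τ) of [2k]. -/
/-- The standardization map: `st T x` is the position of `x` among the elements of `T`,
so the `i`-th smallest element of `T` is sent to `i`. -/
def st (T : Finset ℕ) (x : ℕ) : ℕ :=
  (T.filter (· ≤ x)).card

/-- The restriction `σ ∩ T` of a set partition `σ` to a subset `T`:
the set partition whose blocks are the nonempty sets `st (B ∩ T)` for blocks `B` of `σ`. -/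
def restrict (σ : Finset (Finset ℕ)) (T : Finset ℕ) : Finset (Finset ℕ) :=
  (σ.image fun B => (B ∩ T).image (st T)).filter Finset.Nonempty

/-- `σ` is a set partition of `[n] = {1,…,n}`: pairwise disjoint nonempty blocks
whose union is `{1,…,n}`. -/
def IsPartitionOf (n : ℕ) (σ : Finset (Finset ℕ)) : Prop :=
  (∀ B ∈ σ, B.Nonempty) ∧
  (∀ B ∈ σ, ∀ B' ∈ σ, B ≠ B' → Disjoint B B') ∧
  σ.biUnion id = Finset.Icc 1 n

/-- A set partition `σ` of `[n]` contains the set partition `σ'` if there is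
`T ⊆ [n]` with `σ ∩ T = σ'`. -/
def ContainsPartition (n : ℕ) (σ σ' : Finset (Finset ℕ)) : Prop :=
  ∃ T ⊆ Finset.Icc 1 n, restrict σ T = σ'

/-- `π` is a permutation of `[n] = {1,…,n}`. -/
def IsPermOf (n : ℕ) (π : ℕ → ℕ) : Prop :=
  Set.BijOn π (Set.Icc 1 n) (Set.Icc 1 n)

/-- `i` enumerates indices `i 0 < i 1 < … < i (k-1)` in `[n]` forming an occurrence of
the pattern `τ` (a permutation of `[k]`) in `π` (a permutation of `[n]`):
`π (i j) < π (i j')` iff `τ (j+1) < τ (j'+1)`. -/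
def IsOccurrence (n k : ℕ) (π τ : ℕ → ℕ) (i : Fin k → ℕ) : Prop :=
  StrictMono i ∧ (∀ j, i j ∈ Finset.Icc 1 n) ∧
    ∀ j j' : Fin k, (π (i j) < π (i j') ↔ τ (j.1 + 1) < τ (j'.1 + 1))

/-- `π` (a permutation of `[n]`) contains `τ` (a permutation of `[k]`) as a pattern. -/
def ContainsPerm (n k : ℕ) (π τ : ℕ → ℕ) : Prop :=
  ∃ i : Fin k → ℕ, IsOccurrence n k π τ i

/-- The set partition `s(π) = {{1, π 1 + n}, …, {n, π n + n}}` of `[2n]`. -/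
def sPart (n : ℕ) (π : ℕ → ℕ) : Finset (Finset ℕ) :=
  (Finset.Icc 1 n).image fun i => {i, π i + n}

theorem st_le_card (T : Finset ℕ) (x : ℕ) : st T x ≤ T.card :=
  Finset.card_filter_le _ _

theorem st_pos {T : Finset ℕ} {x : ℕ} (hx : x ∈ T) : 0 < st T x :=
  Finset.card_pos.2 ⟨x, by simp [hx]⟩

theorem st_mono (T : Finset ℕ) : Monotone (st T) := fun x y hxy =>
  Finset.card_le_card fun z hz => by
    simp only [Finset.mem_filter] at hz ⊢
    exact ⟨hz.1, hz.2.trans hxy⟩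

theorem st_lt_st {T : Finset ℕ} {x y : ℕ} (hy : y ∈ T) (hxy : x < y) : st T x < st T y := by
  refine Finset.card_lt_card (Finset.ssubset_iff_of_subset ?_ |>.2 ⟨y, ?_, ?_⟩)
  · intro z hz
    simp only [Finset.mem_filter] at hz ⊢
    exact ⟨hz.1, hz.2.trans hxy.le⟩
  · simp [hy]
  · simp [hxy]

theorem st_lt_st_iff {T : Finset ℕ} {x y : ℕ} (hy : y ∈ T) : st T x < st T y ↔ x < y :=
  ⟨fun h => (st_mono T).reflect_lt h, st_lt_st hy⟩

theorem st_injOn (T : Finset ℕ) : Set.InjOn (st T) T := by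
  intro x hx y hy h
  rcases lt_trichotomy x y with hxy | hxy | hxy
  · exact absurd h (st_lt_st hy hxy).ne
  · exact hxy
  · exact absurd h (st_lt_st hx hxy).ne'

theorem st_Icc {k x : ℕ} (hx : x ≤ k) : st (Finset.Icc 1 k) x = x := by
  have : (Finset.Icc 1 k).filter (· ≤ x) = Finset.Icc 1 x := by
    ext y
    simp only [Finset.mem_filter, Finset.mem_Icc]
    omega
  simp [st, this]

theorem st_image {α : Type*} [DecidableEq α] {S : Finset α} {f : α → ℕ} (hf : Set.InjOn f S)
    (x : ℕ) : st (S.image f) x = (S.filter fun b => f b ≤ x).card := by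
  rw [st, Finset.filter_image, Finset.card_image_of_injOn]
  exact hf.mono (Finset.coe_subset.2 (Finset.filter_subset _ _))

theorem st_image_congr {α : Type*} [DecidableEq α] {S : Finset α} {f g : α → ℕ}
    (hf : Set.InjOn f S) (hg : Set.InjOn g S) {a : α}
    (h : ∀ b ∈ S, f b ≤ f a ↔ g b ≤ g a) :
    st (S.image f) (f a) = st (S.image g) (g a) := by
  rw [st_image hf, st_image hg, Finset.filter_congr h]

theorem pair_eq_pair_of_le_of_lt {m x y x' y' : ℕ} (hx : x ≤ m) (hy : m < y) (hx' : x' ≤ m)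
    (h : ({x, y} : Finset ℕ) = {x', y'}) : x = x' ∧ y = y' := by
  have h₁ : x ∈ ({x', y'} : Finset ℕ) := by simp [← h]
  have h₂ : y ∈ ({x', y'} : Finset ℕ) := by simp [← h]
  simp only [Finset.mem_insert, Finset.mem_singleton] at h₁ h₂
  omega

/-- The union of the blocks of `sPart n π` whose smaller elements form `I`. -/
def blockUnion (n : ℕ) (π : ℕ → ℕ) (I : Finset ℕ) : Finset ℕ :=
  I ∪ (I.image π).image (· + n)

theorem st_blockUnion_left {n : ℕ} {π : ℕ → ℕ} {I : Finset ℕ} {a : ℕ} (ha : a ≤ n)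
    (hI : ∀ b ∈ I, 1 ≤ π b) : st (blockUnion n π I) a = st I a := by
  unfold st blockUnion
  congr 1
  ext x
  simp only [Finset.mem_filter, Finset.mem_union, Finset.mem_image, exists_exists_and_eq_and]
  constructor
  · rintro ⟨hx | ⟨b, hb, rfl⟩, hxa⟩
    · exact ⟨hx, hxa⟩
    · have := hI b hb
      omega
  · rintro ⟨hx, hxa⟩
    exact ⟨Or.inl hx, hxa⟩

theorem st_blockUnion_right {n : ℕ} {π : ℕ → ℕ} {I : Finset ℕ} (hI : I ⊆ Finset.Icc 1 n)
    (hπ : ∀ b ∈ I, 1 ≤ π b) (y : ℕ) :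
    st (blockUnion n π I) (y + n) = st (I.image π) y + I.card := by
  have hI' : I.filter (· ≤ y + n) = I := Finset.filter_true_of_mem fun x hx => by
    have := Finset.mem_Icc.1 (hI hx)
    omega
  have hdisj : Disjoint I (((I.image π).image (· + n)).filter (· ≤ y + n)) := by
    rw [Finset.disjoint_left]
    intro x hx hx'
    simp only [Finset.mem_filter, Finset.mem_image, exists_exists_and_eq_and] at hx'
    obtain ⟨⟨b, hb, rfl⟩, -⟩ := hx'
    have := Finset.mem_Icc.1 (hI hx)
    have := hπ b hb
    omega
  have hinj : Set.InjOn (· + n) ((I.image π : Finset ℕ) : Set ℕ) :=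
    (add_left_injective n).injOn
  have := st_image hinj (y + n)
  unfold st at this ⊢
  rw [blockUnion, Finset.filter_union, hI', Finset.card_union_of_disjoint hdisj, this, add_comm]
  simp

theorem restrict_blockUnion {n : ℕ} {π : ℕ → ℕ} (hπ : IsPermOf n π) {I : Finset ℕ}
    (hI : I ⊆ Finset.Icc 1 n) :
    restrict (sPart n π) (blockUnion n π I) =
      I.image fun a => {st I a, st (I.image π) (π a) + I.card} := by
  have hmaps : ∀ a ∈ Finset.Icc 1 n, 1 ≤ π a ∧ π a ≤ n := fun a ha =>
    hπ.mapsTo (by simpa using ha)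
  have hpos : ∀ b ∈ I, 1 ≤ π b := fun b hb => (hmaps b (hI hb)).1
  have hblock : ∀ a ∈ I, (({a, π a + n} : Finset ℕ) ∩ blockUnion n π I).image
      (st (blockUnion n π I)) = {st I a, st (I.image π) (π a) + I.card} := by
    intro a ha
    rw [Finset.inter_eq_left.2]
    · rw [Finset.image_insert, Finset.image_singleton,
        st_blockUnion_left (Finset.mem_Icc.1 (hI ha)).2 hpos, st_blockUnion_right hI hpos]
    · intro x hx
      simp only [Finset.mem_insert, Finset.mem_singleton] at hx
      simp only [blockUnion, Finset.mem_union, Finset.mem_image, exists_exists_and_eq_and]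
      rcases hx with rfl | rfl
      · exact Or.inl ha
      · exact Or.inr ⟨a, ha, rfl⟩
  have hmem : ∀ a ∈ Finset.Icc 1 n,
      (({a, π a + n} : Finset ℕ) ∩ blockUnion n π I).Nonempty → a ∈ I := by
    rintro a ha ⟨x, hx⟩
    simp only [blockUnion, Finset.mem_inter, Finset.mem_union, Finset.mem_image,
      exists_exists_and_eq_and, Finset.mem_insert, Finset.mem_singleton] at hx
    have ha' := Finset.mem_Icc.1 ha
    have haπ := hmaps a ha
    obtain ⟨rfl | rfl, hx | ⟨b, hb, hbx⟩⟩ := hx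
    · exact hx
    · have := hpos b hb
      omega
    · have := Finset.mem_Icc.1 (hI hx)
      omega
    · have hba : b = a := hπ.injOn (by simpa using hI hb) (by simpa using ha) (by omega)
      exact hba ▸ hb
  ext C
  simp only [restrict, sPart, Finset.mem_filter, Finset.mem_image, exists_exists_and_eq_and]
  constructor
  · rintro ⟨⟨a, ha, rfl⟩, hC⟩
    have haI := hmem a ha (Finset.image_nonempty.1 hC)
    exact ⟨a, haI, (hblock a haI).symm⟩
  · rintro ⟨a, ha, rfl⟩
    exact ⟨⟨a, hI ha, hblock a ha⟩, Finset.insert_nonempty _ _⟩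

theorem image_univ_succ (k : ℕ) :
    (Finset.univ : Finset (Fin k)).image (fun j => j.1 + 1) = Finset.Icc 1 k := by
  ext x
  simp only [Finset.mem_image, Finset.mem_univ, true_and, Finset.mem_Icc]
  constructor
  · rintro ⟨j, rfl⟩
    omega
  · rintro ⟨h₁, h₂⟩
    exact ⟨⟨x - 1, by omega⟩, by simp only; omega⟩

theorem IsPermOf.image_Icc {k : ℕ} {τ : ℕ → ℕ} (hτ : IsPermOf k τ) :
    (Finset.Icc 1 k).image τ = Finset.Icc 1 k := by
  apply Finset.coe_injective
  simpa using hτ.image_eq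

theorem IsOccurrence.restrict_eq {n k : ℕ} {π τ : ℕ → ℕ} (hπ : IsPermOf n π)
    (hτ : IsPermOf k τ) {i : Fin k → ℕ} (hi : IsOccurrence n k π τ i) :
    restrict (sPart n π) (blockUnion n π (Finset.univ.image i)) = sPart k τ := by
  obtain ⟨hmono, hmem, hord⟩ := hi
  have hI : Finset.univ.image i ⊆ Finset.Icc 1 n := by
    simpa [Finset.image_subset_iff] using hmem
  have hcard : (Finset.univ.image i).card = k := by
    simp [Finset.card_image_of_injective _ hmono.injective]
  have hpi : Function.Injective fun j => π (i j) := fun a b hab =>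
    hmono.injective (hπ.injOn (by simpa using hmem a) (by simpa using hmem b) hab)
  have hti : Function.Injective fun j : Fin k => τ (j.1 + 1) := fun a b hab => by
    have := hτ.injOn (Set.mem_Icc.2 ⟨by omega, a.2⟩) (Set.mem_Icc.2 ⟨by omega, b.2⟩) hab
    exact Fin.ext (by omega)
  have hst : ∀ j : Fin k, st (Finset.univ.image i) (i j) = j.1 + 1 := fun j => by
    rw [st_image_congr (g := fun j : Fin k => j.1 + 1) hmono.injective.injOn
      (fun a _ b _ hab => Fin.ext (by simpa using hab))
      (fun b _ => by rw [hmono.le_iff_le]; simp), image_univ_succ]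
    exact st_Icc j.2
  have hst' : ∀ j : Fin k, st ((Finset.univ.image i).image π) (π (i j)) = τ (j.1 + 1) := by
    intro j
    have := st_image_congr (S := Finset.univ) (a := j) hpi.injOn hti.injOn
      (fun b _ => by simpa using not_congr (hord j b))
    have himage : (Finset.univ : Finset (Fin k)).image (fun j => τ (j.1 + 1)) =
        Finset.Icc 1 k := by
      conv_rhs => rw [← hτ.image_Icc, ← image_univ_succ, Finset.image_image]
      rfl
    rw [himage] at this
    rw [Finset.image_image]
    refine Eq.trans this (st_Icc ?_)
    exact (hτ.mapsTo (Set.mem_Icc.2 ⟨by omega, j.2⟩)).2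
  rw [restrict_blockUnion hπ hI, sPart, ← image_univ_succ, Finset.image_image,
    Finset.image_image (s := Finset.univ) (f := fun j : Fin k => j.1 + 1)]
  refine Finset.image_congr fun j _ => ?_
  simp only [Function.comp_apply, hst, hst', hcard]

theorem card_sPart (k : ℕ) {τ : ℕ → ℕ} (hτ : IsPermOf k τ) : (sPart k τ).card = k := by
  rw [sPart, Finset.card_image_of_injOn]
  · simp
  · intro a ha b hb hab
    simp only [Finset.coe_Icc] at ha hb
    have := (hτ.mapsTo ha).1
    exact (pair_eq_pair_of_le_of_lt (m := k) ha.2 (by omega) hb.2 hab).1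

theorem eq_blockUnion_of_restrict_eq {n k : ℕ} {π τ : ℕ → ℕ} (hπ : IsPermOf n π)
    (hτ : IsPermOf k τ) {T : Finset ℕ} (hT : T ⊆ Finset.Icc 1 (2 * n))
    (h : restrict (sPart n π) T = sPart k τ) :
    T = blockUnion n π (T ∩ Finset.Icc 1 n) := by
  have hsub : ∀ a ∈ Finset.Icc 1 n, (({a, π a + n} : Finset ℕ) ∩ T).Nonempty →
      ({a, π a + n} : Finset ℕ) ⊆ T := by
    intro a ha hne
    have hmem : (({a, π a + n} : Finset ℕ) ∩ T).image (st T) ∈ sPart k τ := by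
      rw [← h]
      simp only [restrict, sPart, Finset.mem_filter, Finset.mem_image, exists_exists_and_eq_and]
      exact ⟨⟨a, ha, rfl⟩, hne.image _⟩
    obtain ⟨j, hj, hjeq⟩ := Finset.mem_image.1 hmem
    have hj' : j ∈ Set.Icc 1 k := by simpa using hj
    have hτj := (hτ.mapsTo hj').1
    have hcard : (({a, π a + n} : Finset ℕ) ∩ T).card ≥ 2 := by
      rw [← Finset.card_pair (a := j) (b := τ j + k) (by have := hj'.2; omega), hjeq]
      exact Finset.card_image_le
    exact Finset.inter_eq_left.1
      (Finset.eq_of_subset_of_card_le Finset.inter_subset_left (Finset.card_le_two.trans hcard))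
  ext x
  simp only [blockUnion, Finset.mem_union, Finset.mem_image, exists_exists_and_eq_and,
    Finset.mem_inter]
  constructor
  · intro hx
    have hx' := Finset.mem_Icc.1 (hT hx)
    by_cases hxn : x ≤ n
    · exact Or.inl ⟨hx, Finset.mem_Icc.2 ⟨hx'.1, hxn⟩⟩
    · obtain ⟨a, ha, hax⟩ := hπ.surjOn (Set.mem_Icc.2 ⟨by omega, by omega⟩ : x - n ∈ Set.Icc 1 n)
      have hxa : π a + n = x := by omega
      have ha' : a ∈ Finset.Icc 1 n := by simpa using ha
      refine Or.inr ⟨a, ⟨?_, ha'⟩, hxa⟩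
      exact hsub a ha' ⟨x, by simp [hxa, hx]⟩ (by simp)
  · rintro (⟨hx, -⟩ | ⟨a, ⟨ha, ha'⟩, rfl⟩)
    · exact hx
    · exact hsub a ha' ⟨a, by simp [ha]⟩ (by simp)

theorem containsPerm_of_restrict_blockUnion_eq {n k : ℕ} {π τ : ℕ → ℕ} (hπ : IsPermOf n π)
    (hτ : IsPermOf k τ) {I : Finset ℕ} (hI : I ⊆ Finset.Icc 1 n)
    (h : restrict (sPart n π) (blockUnion n π I) = sPart k τ) : ContainsPerm n k π τ := by
  rw [restrict_blockUnion hπ hI] at h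
  have hpos : ∀ a ∈ I, 0 < st (I.image π) (π a) := fun a ha =>
    st_pos (Finset.mem_image_of_mem π ha)
  have hcard : I.card = k := by
    rw [← card_sPart k hτ, ← h, Finset.card_image_of_injOn]
    intro a ha b hb hab
    have := hpos a ha
    exact st_injOn I ha hb (pair_eq_pair_of_le_of_lt (m := I.card) (st_le_card I a) (by omega)
      (st_le_card I b) hab).1
  have hst : ∀ a ∈ I, τ (st I a) = st (I.image π) (π a) := by
    intro a ha
    have hmem := Finset.mem_image_of_mem
      (fun a => ({st I a, st (I.image π) (π a) + I.card} : Finset ℕ)) ha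
    rw [h] at hmem
    obtain ⟨j, hj, hjeq⟩ := Finset.mem_image.1 hmem
    have hj' : j ∈ Set.Icc 1 k := by simpa using hj
    have hτj := (hτ.mapsTo hj').1
    have h₁ := hpos a ha
    have hle := st_le_card I a
    obtain ⟨rfl, h₂⟩ := pair_eq_pair_of_le_of_lt (m := k) hj'.2 (by omega) (by omega) hjeq
    omega
  let i := I.orderEmbOfFin hcard
  have hiI : ∀ j, i j ∈ I := I.orderEmbOfFin_mem hcard
  have hsti : ∀ j : Fin k, st I (i j) = j.1 + 1 := fun j => by
    have := st_image_congr (S := Finset.univ) (f := i) (g := fun j : Fin k => j.1 + 1) (a := j)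
      i.injective.injOn (fun a _ b _ hab => Fin.ext (by simpa using hab))
      (fun b _ => by rw [i.le_iff_le]; simp)
    rw [image_univ_succ, st_Icc j.2, Finset.image_orderEmbOfFin_univ] at this
    exact this
  refine ⟨i, i.strictMono, fun j => hI (hiI j), fun j j' => ?_⟩
  rw [← hsti, ← hsti, hst _ (hiI j), hst _ (hiI j'),
    st_lt_st_iff (Finset.mem_image_of_mem π (hiI j'))]

/-- `π` contains `τ` as a permutation pattern iff the set partition
`s(π)` of `[2n]` contains the set partition `s(τ)` of `[2k]`. -/
theorem perm_pattern_iff_sPart_pattern (n k : ℕ) (π τ : ℕ → ℕ)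
    (hπ : IsPermOf n π) (hτ : IsPermOf k τ) :
    ContainsPerm n k π τ ↔ ContainsPartition (2 * n) (sPart n π) (sPart k τ) := by
  constructor
  · rintro ⟨i, hi⟩
    refine ⟨blockUnion n π (Finset.univ.image i), ?_, hi.restrict_eq hπ hτ⟩
    intro x hx
    simp only [blockUnion, Finset.mem_union, Finset.mem_image, Finset.mem_univ,
      true_and, exists_exists_eq_and] at hx
    rw [Finset.mem_Icc]
    obtain ⟨j, rfl⟩ | ⟨j, rfl⟩ := hx
    · have := Finset.mem_Icc.1 (hi.2.1 j)
      omega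
    · have : π (i j) ∈ Set.Icc 1 n := hπ.mapsTo (by simpa using hi.2.1 j)
      rw [Set.mem_Icc] at this
      omega
  · rintro ⟨T, hT, h⟩
    have hT' := eq_blockUnion_of_restrict_eq hπ hτ hT h
    rw [hT'] at h
    exact containsPerm_of_restrict_blockUnion_eq hπ hτ Finset.inter_subset_right h
end

section
/- Let π be a permutation of [n] and τ a permutation of [k], and suppose i_1 < … < i_k are indices such that π_{i_1}…π_{i_k} is an occurrence of τ in π (i.e., π_{i_j} < π_{i_{j'}} iff τ_j < τ_{j'}). Set T = {i_1, …, i_k, π_{i_1}+n, …, π_{i_k}+n} ⊆ [2n]. Then s(π) ∩ T = s(τ). In particular, if π contains τ then s(π) contains s(τ). -/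
theorem IsPermOf.card_filter_le {k : ℕ} {τ : ℕ → ℕ} (hτ : IsPermOf k τ) (j : Fin k) :
    (Finset.univ.filter fun j' : Fin k => τ (j'.1 + 1) ≤ τ (j.1 + 1)).card = τ (j.1 + 1) := by
  have mem (j : Fin k) : j.1 + 1 ∈ Set.Icc 1 k := ⟨by omega, by omega⟩
  have inj : Function.Injective fun j : Fin k => τ (j.1 + 1) := fun a b hab =>
    Fin.ext (Nat.succ_injective (hτ.injOn (mem a) (mem b) hab))
  have image_eq : (Finset.univ.filter fun j' : Fin k => τ (j'.1 + 1) ≤ τ (j.1 + 1)).image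
      (fun j : Fin k => τ (j.1 + 1)) = Finset.Icc 1 (τ (j.1 + 1)) := by
    ext x
    simp only [Finset.mem_image, Finset.mem_filter, Finset.mem_univ, true_and, Finset.mem_Icc]
    constructor
    · rintro ⟨a, ha, rfl⟩
      exact ⟨(hτ.mapsTo (mem a)).1, ha⟩
    · rintro ⟨h1, h2⟩
      obtain ⟨m, ⟨hm1, hmk⟩, rfl⟩ := hτ.surjOn ⟨h1, h2.trans (hτ.mapsTo (mem j)).2⟩
      refine ⟨⟨m - 1, by omega⟩, ?_⟩
      simp only [Nat.sub_add_cancel hm1, and_true]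
      exact h2
  rw [← Finset.card_image_of_injective _ inj, image_eq, Nat.card_Icc, Nat.add_sub_cancel]

/-- The set `{i₁, …, i_k, π i₁ + n, …, π i_k + n}` attached to the indices `i`. -/
def occurrenceSet (n k : ℕ) (π : ℕ → ℕ) (i : Fin k → ℕ) : Finset ℕ :=
  Finset.image i Finset.univ ∪ Finset.image (fun j => π (i j) + n) Finset.univ

theorem mem_occurrenceSet {n k : ℕ} {π : ℕ → ℕ} {i : Fin k → ℕ} {x : ℕ} :
    x ∈ occurrenceSet n k π i ↔ (∃ j, i j = x) ∨ ∃ j, π (i j) + n = x := by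
  simp [occurrenceSet]

namespace IsOccurrence

variable {n k : ℕ} {π τ : ℕ → ℕ} {i : Fin k → ℕ}

theorem mem_Icc (hi : IsOccurrence n k π τ i) (j : Fin k) : i j ∈ Set.Icc 1 n :=
  Finset.mem_Icc.1 (hi.2.1 j)

theorem st_index (hπ : IsPermOf n π) (hi : IsOccurrence n k π τ i) (j : Fin k) :
    st (occurrenceSet n k π i) (i j) = j.1 + 1 := by
  have filter_eq : (occurrenceSet n k π i).filter (· ≤ i j) = (Finset.Iic j).image i := by
    ext x
    simp only [Finset.mem_filter, mem_occurrenceSet, Finset.mem_image, Finset.mem_Iic]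
    constructor
    · rintro ⟨⟨a, rfl⟩ | ⟨a, rfl⟩, h⟩
      · exact ⟨a, hi.1.le_iff_le.1 h, rfl⟩
      · have h1 := (hπ.mapsTo (hi.mem_Icc a)).1
        have h2 := (hi.mem_Icc j).2
        omega
    · rintro ⟨a, ha, rfl⟩
      exact ⟨.inl ⟨a, rfl⟩, hi.1.monotone ha⟩
  rw [st, filter_eq, Finset.card_image_of_injective _ hi.1.injective, Fin.card_Iic]

theorem st_value (hπ : IsPermOf n π) (hτ : IsPermOf k τ) (hi : IsOccurrence n k π τ i)
    (j : Fin k) : st (occurrenceSet n k π i) (π (i j) + n) = τ (j.1 + 1) + k := by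
  have le_iff (a b : Fin k) : π (i a) ≤ π (i b) ↔ τ (a.1 + 1) ≤ τ (b.1 + 1) := by
    rw [← not_lt, hi.2.2, not_lt]
  have inj : Function.Injective fun j => π (i j) + n := fun a b hab =>
    hi.1.injective (hπ.injOn (hi.mem_Icc a) (hi.mem_Icc b) (Nat.add_right_cancel hab))
  have filter_eq : (occurrenceSet n k π i).filter (· ≤ π (i j) + n) =
      Finset.univ.image i ∪
        (Finset.univ.filter fun j' : Fin k => τ (j'.1 + 1) ≤ τ (j.1 + 1)).image
          (fun j => π (i j) + n) := by
    ext x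
    simp only [Finset.mem_filter, mem_occurrenceSet, Finset.mem_image, Finset.mem_union,
      Finset.mem_univ, true_and]
    constructor
    · rintro ⟨⟨a, rfl⟩ | ⟨a, rfl⟩, h⟩
      · exact .inl ⟨a, rfl⟩
      · exact .inr ⟨a, (le_iff a j).1 (Nat.le_of_add_le_add_right h), rfl⟩
    · rintro (⟨a, rfl⟩ | ⟨a, ha, rfl⟩)
      · exact ⟨.inl ⟨a, rfl⟩, (hi.mem_Icc a).2.trans (Nat.le_add_left _ _)⟩
      · exact ⟨.inr ⟨a, rfl⟩, Nat.add_le_add_right ((le_iff a j).2 ha) n⟩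
  have disj : Disjoint (Finset.univ.image i)
      ((Finset.univ.filter fun j' : Fin k => τ (j'.1 + 1) ≤ τ (j.1 + 1)).image
        (fun j => π (i j) + n)) := by
    simp only [Finset.disjoint_left, Finset.mem_image, Finset.mem_univ, true_and]
    rintro _ ⟨a, rfl⟩ ⟨b, -, hb⟩
    have h1 := (hπ.mapsTo (hi.mem_Icc b)).1
    have h2 := (hi.mem_Icc a).2
    omega
  rw [st, filter_eq, Finset.card_union_of_disjoint disj,
    Finset.card_image_of_injective _ hi.1.injective, Finset.card_image_of_injective _ inj,
    hτ.card_filter_le, Finset.card_univ, Fintype.card_fin, Nat.add_comm]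

theorem image_st_block (hπ : IsPermOf n π) (hτ : IsPermOf k τ) (hi : IsOccurrence n k π τ i)
    (j : Fin k) :
    (({i j, π (i j) + n} : Finset ℕ) ∩ occurrenceSet n k π i).image
      (st (occurrenceSet n k π i)) = {j.1 + 1, τ (j.1 + 1) + k} := by
  have hsub : ({i j, π (i j) + n} : Finset ℕ) ⊆ occurrenceSet n k π i := by
    simp only [Finset.insert_subset_iff, Finset.singleton_subset_iff, mem_occurrenceSet]
    exact ⟨.inl ⟨j, rfl⟩, .inr ⟨j, rfl⟩⟩
  rw [Finset.inter_eq_left.2 hsub, Finset.image_insert, Finset.image_singleton,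
    hi.st_index hπ, hi.st_value hπ hτ]

theorem exists_index_of_mem_block (hπ : IsPermOf n π) (hi : IsOccurrence n k π τ i) {m x : ℕ}
    (hm : m ∈ Set.Icc 1 n) (hx : x ∈ ({m, π m + n} : Finset ℕ))
    (hxT : x ∈ occurrenceSet n k π i) : ∃ j, i j = m := by
  rw [Finset.mem_insert, Finset.mem_singleton] at hx
  have hm1 := (hπ.mapsTo hm).1
  have hmn := hm.2
  rcases hx with rfl | rfl <;> rcases mem_occurrenceSet.1 hxT with ⟨j, h⟩ | ⟨j, h⟩
  · exact ⟨j, h⟩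
  · have := (hπ.mapsTo (hi.mem_Icc j)).1
    omega
  · have := (hi.mem_Icc j).2
    omega
  · exact ⟨j, hπ.injOn (hi.mem_Icc j) hm (Nat.add_right_cancel h)⟩

theorem restrict_sPart (hπ : IsPermOf n π) (hτ : IsPermOf k τ) (hi : IsOccurrence n k π τ i) :
    restrict (sPart n π) (occurrenceSet n k π i) = sPart k τ := by
  ext S
  simp only [restrict, sPart, Finset.mem_filter, Finset.mem_image, exists_exists_and_eq_and]
  constructor
  · rintro ⟨⟨m, hm, rfl⟩, hne⟩
    obtain ⟨x, hx⟩ := Finset.image_nonempty.1 hne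
    obtain ⟨hxB, hxT⟩ := Finset.mem_inter.1 hx
    obtain ⟨j, rfl⟩ := hi.exists_index_of_mem_block hπ (Finset.mem_Icc.1 hm) hxB hxT
    exact ⟨j.1 + 1, Finset.mem_Icc.2 ⟨by omega, by omega⟩, (hi.image_st_block hπ hτ j).symm⟩
  · rintro ⟨m, hm, rfl⟩
    obtain ⟨hm1, hmk⟩ := Finset.mem_Icc.1 hm
    have h := hi.image_st_block hπ hτ ⟨m - 1, by omega⟩
    simp only [Nat.sub_add_cancel hm1] at h
    exact ⟨⟨_, hi.2.1 _, h⟩, Finset.insert_nonempty _ _⟩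

theorem occurrenceSet_subset (hπ : IsPermOf n π) (hi : IsOccurrence n k π τ i) :
    occurrenceSet n k π i ⊆ Finset.Icc 1 (2 * n) := by
  intro x hx
  rw [Finset.mem_Icc]
  rcases mem_occurrenceSet.1 hx with ⟨j, rfl⟩ | ⟨j, rfl⟩
  · obtain ⟨h1, h2⟩ := hi.mem_Icc j
    omega
  · obtain ⟨h1, h2⟩ := hπ.mapsTo (hi.mem_Icc j)
    omega

end IsOccurrence


/-- If `i₁ < … < i_k` is an occurrence of `τ` in `π` and
`T = {i₁, …, i_k, π i₁ + n, …, π i_k + n}`, then `s(π) ∩ T = s(τ)`.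
In particular, if `π` contains `τ` then `s(π)` contains `s(τ)`. -/
theorem restrict_sPart_of_occurrence (n k : ℕ) (π τ : ℕ → ℕ)
    (hπ : IsPermOf n π) (hτ : IsPermOf k τ)
    (i : Fin k → ℕ) (hi : IsOccurrence n k π τ i) :
    restrict (sPart n π)
        (Finset.image i Finset.univ ∪ Finset.image (fun j => π (i j) + n) Finset.univ)
      = sPart k τ ∧
    (ContainsPerm n k π τ → ContainsPartition (2 * n) (sPart n π) (sPart k τ)) := by
  refine ⟨hi.restrict_sPart hπ hτ, ?_⟩
  rintro ⟨i', hi'⟩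
  exact ⟨_, hi'.occurrenceSet_subset hπ, hi'.restrict_sPart hπ hτ⟩
end

section
/- Let π be a permutation of [n] and τ a permutation of [k], and suppose T ⊆ [2n] satisfies s(π) ∩ T = s(τ). Then T is a union of k complete blocks of s(π); that is, T = {i_1, …, i_k} ∪ {π_{i_1}+n, …, π_{i_k}+n} for some indices i_1 < … < i_k in [n], and moreover π_{i_1}…π_{i_k} is an occurrence of τ in π (i.e., π_{i_j} < π_{i_{j'}} iff τ_j < τ_{j'}). In particular, if s(π) contains s(τ) then π contains τ. -/
/-- If the trace on `T` of the pair `x < y` standardizes to a pair `c < d`, then both `x` and `y`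
lie in `T` and they are sent to `c` and `d` respectively. -/
theorem mem_and_st_eq_of_image_pair_inter {T : Finset ℕ} {x y c d : ℕ} (hxy : x < y) (hcd : c < d)
    (h : (({x, y} : Finset ℕ) ∩ T).image (st T) = {c, d}) :
    x ∈ T ∧ y ∈ T ∧ st T x = c ∧ st T y = d := by
  have hc : c ∈ (({x, y} : Finset ℕ) ∩ T).image (st T) := by simp [h]
  have hd : d ∈ (({x, y} : Finset ℕ) ∩ T).image (st T) := by simp [h]
  simp only [Finset.mem_image, Finset.mem_inter, Finset.mem_insert, Finset.mem_singleton] at hc hd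
  obtain ⟨u, ⟨hu, huT⟩, rfl⟩ := hc
  obtain ⟨v, ⟨hv, hvT⟩, rfl⟩ := hd
  rw [st_lt_st_iff hvT] at hcd
  obtain ⟨rfl, rfl⟩ : u = x ∧ v = y := by omega
  exact ⟨huT, hvT, rfl, rfl⟩

theorem exists_occurrence_of_restrict_sPart {n k : ℕ} {π τ : ℕ → ℕ}
    (hπ : IsPermOf n π) (hτ : IsPermOf k τ)
    {T : Finset ℕ} (hT : T ⊆ Finset.Icc 1 (2 * n))
    (h : restrict (sPart n π) T = sPart k τ) :
    ∃ i : Fin k → ℕ, IsOccurrence n k π τ i ∧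
      T = Finset.image i Finset.univ ∪ Finset.image (fun j => π (i j) + n) Finset.univ := by
  have hπ_lt : ∀ x, 1 ≤ x → x ≤ n → x < π x + n := fun x h1 h2 => by
    have := (hπ.mapsTo ⟨h1, h2⟩).1
    omega
  have hτ_lt : ∀ c, 1 ≤ c → c ≤ k → c < τ c + k := fun c h1 h2 => by
    have := (hτ.mapsTo ⟨h1, h2⟩).1
    omega
  have block : ∀ x, 1 ≤ x → x ≤ n → x ∈ T ∨ π x + n ∈ T →
      x ∈ T ∧ π x + n ∈ T ∧ 1 ≤ st T x ∧ st T x ≤ k ∧ st T (π x + n) = τ (st T x) + k := by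
    intro x h1 h2 hx
    have hmem : (({x, π x + n} : Finset ℕ) ∩ T).image (st T) ∈ sPart k τ := by
      rw [← h, restrict, Finset.mem_filter]
      refine ⟨Finset.mem_image_of_mem _
        (Finset.mem_image_of_mem _ (Finset.mem_Icc.2 ⟨h1, h2⟩)), ?_⟩
      rw [Finset.image_nonempty]
      rcases hx with hx | hx
      · exact ⟨x, by simp [hx]⟩
      · exact ⟨π x + n, by simp [hx]⟩
    obtain ⟨c, hc, hceq⟩ := Finset.mem_image.1 hmem
    rw [Finset.mem_Icc] at hc
    obtain ⟨hxT, hyT, rfl, hy⟩ := mem_and_st_eq_of_image_pair_inter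
      (hπ_lt x h1 h2) (hτ_lt c hc.1 hc.2) hceq.symm
    exact ⟨hxT, hyT, hc.1, hc.2, hy⟩
  have surj : ∀ j : Fin k, ∃ x, 1 ≤ x ∧ x ≤ n ∧ x ∈ T ∧ st T x = j.1 + 1 := by
    intro j
    have hj : ({j.1 + 1, τ (j.1 + 1) + k} : Finset ℕ) ∈ restrict (sPart n π) T := by
      rw [h]
      exact Finset.mem_image_of_mem (fun i => ({i, τ i + k} : Finset ℕ))
        (Finset.mem_Icc.2 ⟨by omega, j.2⟩)
    obtain ⟨B, hB, hBeq⟩ := Finset.mem_image.1 (Finset.mem_filter.1 hj).1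
    obtain ⟨x, hx, rfl⟩ := Finset.mem_image.1 hB
    rw [Finset.mem_Icc] at hx
    obtain ⟨hxT, -, hst, -⟩ := mem_and_st_eq_of_image_pair_inter
      (hπ_lt x hx.1 hx.2) (hτ_lt _ (by omega) j.2) hBeq
    exact ⟨x, hx.1, hx.2, hxT, hst⟩
  choose i hi1 hin hiT hist using surj
  have exists_index : ∀ x, 1 ≤ x → x ≤ n → x ∈ T → ∃ j, i j = x := by
    intro x h1 h2 hxT
    obtain ⟨-, -, hc1, hck, -⟩ := block x h1 h2 (Or.inl hxT)
    refine ⟨⟨st T x - 1, by omega⟩, st_injOn T (hiT _) hxT ?_⟩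
    rw [hist]
    exact Nat.sub_add_cancel hc1
  have hi_block := fun j => block (i j) (hi1 j) (hin j) (Or.inl (hiT j))
  refine ⟨i, ⟨?_, fun j => Finset.mem_Icc.2 ⟨hi1 j, hin j⟩, ?_⟩, ?_⟩
  · intro j j' hjj'
    rw [← st_lt_st_iff (hiT j'), hist, hist]
    exact Nat.succ_lt_succ hjj'
  · intro j j'
    obtain ⟨-, -, -, -, hj⟩ := hi_block j
    obtain ⟨-, hT', -, -, hj'⟩ := hi_block j'
    rw [← add_lt_add_iff_right n, ← st_lt_st_iff hT', hj, hj', hist, hist, add_lt_add_iff_right]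
  · ext x
    simp only [Finset.mem_union, Finset.mem_image, Finset.mem_univ, true_and]
    constructor
    · intro hxT
      have hx := Finset.mem_Icc.1 (hT hxT)
      by_cases hxn : x ≤ n
      · exact Or.inl (exists_index x hx.1 hxn hxT)
      · obtain ⟨y, hy, hyx⟩ := hπ.surjOn (show x - n ∈ Set.Icc 1 n from ⟨by omega, by omega⟩)
        obtain rfl : π y + n = x := by omega
        obtain ⟨j, rfl⟩ := exists_index y hy.1 hy.2 (block y hy.1 hy.2 (Or.inr hxT)).1
        exact Or.inr ⟨j, rfl⟩
    · rintro (⟨j, rfl⟩ | ⟨j, rfl⟩)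
      · exact hiT j
      · exact (hi_block j).2.1

/-- If `T ⊆ [2n]` satisfies `s(π) ∩ T = s(τ)`, then `T` is a union of `k`
complete blocks of `s(π)`: `T = {i₁, …, i_k} ∪ {π i₁ + n, …, π i_k + n}` for some indices
`i₁ < … < i_k` in `[n]`, which moreover form an occurrence of `τ` in `π`.
In particular, if `s(π)` contains `s(τ)` then `π` contains `τ`. -/
theorem occurrence_of_restrict_sPart (n k : ℕ) (π τ : ℕ → ℕ)
    (hπ : IsPermOf n π) (hτ : IsPermOf k τ)
    (T : Finset ℕ) (hT : T ⊆ Finset.Icc 1 (2 * n))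
    (h : restrict (sPart n π) T = sPart k τ) :
    (∃ i : Fin k → ℕ, IsOccurrence n k π τ i ∧
        T = Finset.image i Finset.univ ∪ Finset.image (fun j => π (i j) + n) Finset.univ) ∧
    (ContainsPartition (2 * n) (sPart n π) (sPart k τ) → ContainsPerm n k π τ) := by
  refine ⟨exists_occurrence_of_restrict_sPart hπ hτ hT h, ?_⟩
  rintro ⟨T', hT', h'⟩
  obtain ⟨i, hi, -⟩ := exists_occurrence_of_restrict_sPart hπ hτ hT' h'
  exact ⟨i, hi⟩
end

section
/- Let π be a permutation of [n] and τ a permutation of [k]. The map sending an occurrence (i_1 < … < i_k with π_{i_1}…π_{i_k} order isomorphic to τ) to the set T = {i_1, …, i_k, π_{i_1}+n, …, π_{i_k}+n} is a bijection between the occurrences of τ in π and the subsets T ⊆ [2n] with s(π) ∩ T = s(τ). In particular, the number of occurrences of τ in π equals the number of subsets T ⊆ [2n] with s(π) ∩ T = s(τ). -/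
/-- The rank of the entry `a j` among the entries of `a`. -/
def entryRank {k : ℕ} (a : Fin k → ℕ) (j : Fin k) : ℕ :=
  (Finset.univ.filter fun j' => a j' ≤ a j).card

theorem one_le_entryRank {k : ℕ} (a : Fin k → ℕ) (j : Fin k) : 1 ≤ entryRank a j :=
  Finset.card_pos.mpr ⟨j, by simp⟩

theorem entryRank_mono {k : ℕ} (a : Fin k → ℕ) {j j' : Fin k} (h : a j ≤ a j') :
    entryRank a j ≤ entryRank a j' := by
  refine Finset.card_le_card fun x hx => ?_
  simp only [Finset.mem_filter, Finset.mem_univ, true_and] at hx ⊢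
  exact hx.trans h

theorem entryRank_lt_iff {k : ℕ} (a : Fin k → ℕ) (j j' : Fin k) :
    entryRank a j < entryRank a j' ↔ a j < a j' := by
  constructor
  · intro h
    by_contra! hle
    exact absurd (entryRank_mono a hle) (not_le.mpr h)
  · intro h
    refine Finset.card_lt_card (Finset.ssubset_iff_of_subset ?_ |>.mpr ⟨j', ?_, ?_⟩)
    · intro x hx
      simp only [Finset.mem_filter, Finset.mem_univ, true_and] at hx ⊢
      omega
    · simp
    · simpa using h

theorem entryRank_congr {k : ℕ} {a b : Fin k → ℕ}
    (h : ∀ j j', a j < a j' ↔ b j < b j') : entryRank a = entryRank b := by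
  funext j
  refine congrArg Finset.card (Finset.filter_congr fun j' _ => ?_)
  rw [← not_lt, ← not_lt, h]

theorem entryRank_of_isPermOf {k : ℕ} {τ : ℕ → ℕ} (hτ : IsPermOf k τ) :
    entryRank (fun j : Fin k => τ (j.1 + 1)) = fun j => τ (j.1 + 1) := by
  funext j
  have hmaps (l : Fin k) : 1 ≤ τ (l.1 + 1) ∧ τ (l.1 + 1) ≤ k :=
    hτ.mapsTo ⟨by omega, by omega⟩
  have himage : (Finset.univ.filter fun j' : Fin k => τ (j'.1 + 1) ≤ τ (j.1 + 1)).image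
      (fun j' => τ (j'.1 + 1)) = Finset.Icc 1 (τ (j.1 + 1)) := by
    ext x
    simp only [Finset.mem_image, Finset.mem_filter, Finset.mem_univ, true_and, Finset.mem_Icc]
    constructor
    · rintro ⟨l, hl, rfl⟩
      exact ⟨(hmaps l).1, hl⟩
    · rintro ⟨h1, hx⟩
      obtain ⟨m, ⟨hm1, hmk⟩, rfl⟩ := hτ.surjOn (show x ∈ Set.Icc 1 k from
        ⟨h1, hx.trans (hmaps j).2⟩)
      have hm : m - 1 + 1 = m := by omega
      exact ⟨⟨m - 1, by omega⟩, by simpa only [hm] using hx, by simp only [hm]⟩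
  have hinj : Function.Injective fun j' : Fin k => τ (j'.1 + 1) := by
    intro x y hxy
    have := hτ.injOn (show x.1 + 1 ∈ Set.Icc 1 k from ⟨by omega, by omega⟩)
      (show y.1 + 1 ∈ Set.Icc 1 k from ⟨by omega, by omega⟩) hxy
    exact Fin.ext (by omega)
  rw [entryRank, ← Finset.card_image_of_injective _ hinj, himage, Nat.card_Icc]
  omega

/-- The set partition with blocks `{j, r_j + k}` for `j ∈ [k]`, with `r` indexed from `0`. -/
def pairBlocks (k : ℕ) (r : Fin k → ℕ) : Finset (Finset ℕ) :=
  Finset.univ.image fun j : Fin k => {j.1 + 1, r j + k}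

theorem pair_eq_pair {k : ℕ} {r r' : Fin k → ℕ} (hr : ∀ j, 1 ≤ r j) (hr' : ∀ j, 1 ≤ r' j)
    {j j' : Fin k} (h : ({j.1 + 1, r j + k} : Finset ℕ) = {j'.1 + 1, r' j' + k}) :
    j = j' ∧ r j = r' j' := by
  have h1 : j.1 + 1 ∈ ({j'.1 + 1, r' j' + k} : Finset ℕ) := h ▸ by simp
  have h2 : r j + k ∈ ({j'.1 + 1, r' j' + k} : Finset ℕ) := h ▸ by simp
  simp only [Finset.mem_insert, Finset.mem_singleton] at h1 h2
  have := hr j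
  have := hr' j'
  exact ⟨Fin.ext (by omega), by omega⟩

theorem card_pairBlocks {k : ℕ} {r : Fin k → ℕ} (hr : ∀ j, 1 ≤ r j) :
    (pairBlocks k r).card = k := by
  rw [pairBlocks, Finset.card_image_of_injective _ fun j j' h => (pair_eq_pair hr hr h).1,
    Finset.card_univ, Fintype.card_fin]

theorem pairBlocks_injective {k : ℕ} {r r' : Fin k → ℕ} (hr : ∀ j, 1 ≤ r j)
    (hr' : ∀ j, 1 ≤ r' j) (h : pairBlocks k r = pairBlocks k r') : r = r' := by
  funext j
  have hj : ({j.1 + 1, r j + k} : Finset ℕ) ∈ pairBlocks k r' :=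
    h ▸ Finset.mem_image_of_mem _ (Finset.mem_univ j)
  obtain ⟨j', -, hj'⟩ := Finset.mem_image.mp hj
  obtain ⟨rfl, h'⟩ := pair_eq_pair hr' hr hj'
  exact h'.symm

theorem sPart_eq_pairBlocks (k : ℕ) (τ : ℕ → ℕ) :
    sPart k τ = pairBlocks k fun j => τ (j.1 + 1) := by
  ext B
  simp only [sPart, pairBlocks, Finset.mem_image, Finset.mem_Icc, Finset.mem_univ, true_and]
  constructor
  · rintro ⟨m, hm, rfl⟩
    have hm' : m - 1 + 1 = m := by omega
    exact ⟨⟨m - 1, by omega⟩, by simp only [hm']⟩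
  · rintro ⟨j, rfl⟩
    exact ⟨j.1 + 1, by omega, rfl⟩

/-- The set `{i₁, …, i_k, π i₁ + n, …, π i_k + n}` attached to indices `i₁, …, i_k`. -/
def supportSet (n : ℕ) {k : ℕ} (π : ℕ → ℕ) (i : Fin k → ℕ) : Finset ℕ :=
  Finset.image i Finset.univ ∪ Finset.image (fun j => π (i j) + n) Finset.univ

theorem mem_supportSet {n k : ℕ} {π : ℕ → ℕ} {i : Fin k → ℕ} {x : ℕ} :
    x ∈ supportSet n π i ↔ (∃ j, i j = x) ∨ ∃ j, π (i j) + n = x := by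
  simp [supportSet]

section Support

variable {n k : ℕ} {π : ℕ → ℕ} {i : Fin k → ℕ}

theorem st_supportSet_index (hπ : IsPermOf n π) (hi : StrictMono i)
    (hin : ∀ j, i j ∈ Finset.Icc 1 n) (j : Fin k) :
    st (supportSet n π i) (i j) = j.1 + 1 := by
  have h : (supportSet n π i).filter (· ≤ i j) = (Finset.Iic j).image i := by
    ext x
    simp only [Finset.mem_filter, mem_supportSet, Finset.mem_image, Finset.mem_Iic]
    constructor
    · rintro ⟨⟨l, rfl⟩ | ⟨l, rfl⟩, hx⟩
      · exact ⟨l, hi.le_iff_le.mp hx, rfl⟩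
      · have hl : 1 ≤ π (i l) := (hπ.mapsTo (Finset.mem_Icc.mp (hin l))).1
        have hj := (Finset.mem_Icc.mp (hin j)).2
        omega
    · rintro ⟨l, hl, rfl⟩
      exact ⟨.inl ⟨l, rfl⟩, hi.monotone hl⟩
  rw [st, h, Finset.card_image_of_injective _ hi.injective, Fin.card_Iic]

theorem st_supportSet_value (hπ : IsPermOf n π) (hi : StrictMono i)
    (hin : ∀ j, i j ∈ Finset.Icc 1 n) (j : Fin k) :
    st (supportSet n π i) (π (i j) + n) = entryRank (fun l => π (i l)) j + k := by
  have hpos (l : Fin k) : 1 ≤ π (i l) := (hπ.mapsTo (Finset.mem_Icc.mp (hin l))).1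
  have h : (supportSet n π i).filter (· ≤ π (i j) + n) =
      (Finset.univ.filter fun l => π (i l) ≤ π (i j)).image (fun l => π (i l) + n) ∪
        Finset.univ.image i := by
    ext x
    simp only [Finset.mem_filter, mem_supportSet, Finset.mem_union, Finset.mem_image,
      Finset.mem_univ, true_and]
    constructor
    · rintro ⟨⟨l, rfl⟩ | ⟨l, rfl⟩, hx⟩
      · exact .inr ⟨l, rfl⟩
      · exact .inl ⟨l, by omega, rfl⟩
    · rintro (⟨l, hl, rfl⟩ | ⟨l, rfl⟩)
      · exact ⟨.inr ⟨l, rfl⟩, by omega⟩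
      · have := (Finset.mem_Icc.mp (hin l)).2
        exact ⟨.inl ⟨l, rfl⟩, by omega⟩
  have hdisj : Disjoint
      ((Finset.univ.filter fun l => π (i l) ≤ π (i j)).image (fun l => π (i l) + n))
      (Finset.univ.image i) := by
    rw [Finset.disjoint_left]
    simp only [Finset.mem_image, Finset.mem_filter, Finset.mem_univ, true_and]
    rintro _ ⟨l, -, rfl⟩ ⟨l', hl'⟩
    have := (Finset.mem_Icc.mp (hin l')).2
    have := hpos l
    omega
  have hinj : Function.Injective fun l => π (i l) + n := fun l l' hl =>
    hi.injective (hπ.injOn (Finset.mem_Icc.mp (hin l)) (Finset.mem_Icc.mp (hin l'))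
      (Nat.add_right_cancel hl))
  rw [st, h, Finset.card_union_of_disjoint hdisj, Finset.card_image_of_injective _ hinj,
    Finset.card_image_of_injective _ hi.injective, Finset.card_univ, Fintype.card_fin, entryRank]

theorem index_mem_supportSet_iff (hπ : IsPermOf n π) (hin : ∀ j, i j ∈ Finset.Icc 1 n) {m : ℕ}
    (hm : m ≤ n) : m ∈ supportSet n π i ↔ ∃ j, i j = m := by
  rw [mem_supportSet, or_iff_left_iff_imp]
  rintro ⟨l, hl⟩
  have : 1 ≤ π (i l) := (hπ.mapsTo (Finset.mem_Icc.mp (hin l))).1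
  omega

theorem value_mem_supportSet_iff (hπ : IsPermOf n π) (hin : ∀ j, i j ∈ Finset.Icc 1 n) {m : ℕ}
    (hm : m ∈ Finset.Icc 1 n) : π m + n ∈ supportSet n π i ↔ ∃ j, i j = m := by
  rw [mem_supportSet]
  constructor
  · rintro (⟨l, hl⟩ | ⟨l, hl⟩)
    · have : 1 ≤ π m := (hπ.mapsTo (Finset.mem_Icc.mp hm)).1
      have := (Finset.mem_Icc.mp (hin l)).2
      omega
    · exact ⟨l, hπ.injOn (Finset.mem_Icc.mp (hin l)) (Finset.mem_Icc.mp hm)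
        (Nat.add_right_cancel hl)⟩
  · rintro ⟨l, rfl⟩
    exact .inr ⟨l, rfl⟩

theorem restrict_supportSet (hπ : IsPermOf n π) (hi : StrictMono i)
    (hin : ∀ j, i j ∈ Finset.Icc 1 n) :
    restrict (sPart n π) (supportSet n π i) =
      pairBlocks k (entryRank fun j => π (i j)) := by
  have hblock (j : Fin k) :
      (({i j, π (i j) + n} : Finset ℕ) ∩ supportSet n π i).image (st (supportSet n π i)) =
        {j.1 + 1, entryRank (fun l => π (i l)) j + k} := by
    have hsub : ({i j, π (i j) + n} : Finset ℕ) ⊆ supportSet n π i := by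
      intro x hx
      rcases Finset.mem_insert.mp hx with rfl | hx
      · exact mem_supportSet.mpr (.inl ⟨j, rfl⟩)
      · exact mem_supportSet.mpr (.inr ⟨j, (Finset.mem_singleton.mp hx).symm⟩)
    rw [Finset.inter_eq_left.mpr hsub, Finset.image_insert, Finset.image_singleton,
      st_supportSet_index hπ hi hin, st_supportSet_value hπ hi hin]
  ext C
  simp only [restrict, sPart, pairBlocks, Finset.mem_filter, Finset.mem_image,
    Finset.mem_univ, true_and, exists_exists_and_eq_and]
  constructor
  · rintro ⟨⟨m, hm, rfl⟩, hne⟩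
    obtain ⟨x, hx⟩ := Finset.image_nonempty.mp hne
    rw [Finset.mem_inter, Finset.mem_insert, Finset.mem_singleton] at hx
    have : ∃ j, i j = m := by
      rcases hx with ⟨rfl | rfl, hx⟩
      · exact (index_mem_supportSet_iff hπ hin (Finset.mem_Icc.mp hm).2).mp hx
      · exact (value_mem_supportSet_iff hπ hin hm).mp hx
    obtain ⟨j, rfl⟩ := this
    exact ⟨j, (hblock j).symm⟩
  · rintro ⟨j, rfl⟩
    exact ⟨⟨i j, hin j, hblock j⟩, Finset.insert_nonempty _ _⟩

theorem supportSet_subset_Icc (hπ : IsPermOf n π) (hin : ∀ j, i j ∈ Finset.Icc 1 n) :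
    supportSet n π i ⊆ Finset.Icc 1 (2 * n) := by
  intro x hx
  rw [Finset.mem_Icc]
  rcases mem_supportSet.mp hx with ⟨j, rfl⟩ | ⟨j, rfl⟩
  · have := Finset.mem_Icc.mp (hin j)
    omega
  · have : 1 ≤ π (i j) ∧ π (i j) ≤ n := hπ.mapsTo (Finset.mem_Icc.mp (hin j))
    omega

theorem supportSet_injOn (hπ : IsPermOf n π) :
    Set.InjOn (supportSet n π) {i : Fin k → ℕ | StrictMono i ∧ ∀ j, i j ∈ Finset.Icc 1 n} := by
  rintro i ⟨hi, hin⟩ i' ⟨hi', hin'⟩ h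
  rw [← hi.range_inj hi']
  ext m
  by_cases hm : m ≤ n
  · rw [Set.mem_range, ← index_mem_supportSet_iff hπ hin hm, h,
      index_mem_supportSet_iff hπ hin' hm, Set.mem_range]
  · refine iff_of_false ?_ ?_
    · rintro ⟨j, rfl⟩
      exact hm (Finset.mem_Icc.mp (hin j)).2
    · rintro ⟨j, rfl⟩
      exact hm (Finset.mem_Icc.mp (hin' j)).2

end Support

theorem card_of_mem_sPart {k : ℕ} {τ : ℕ → ℕ} (hτ : IsPermOf k τ) {B : Finset ℕ}
    (hB : B ∈ sPart k τ) : B.card = 2 := by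
  obtain ⟨m, hm, rfl⟩ := Finset.mem_image.mp hB
  have h1 : 1 ≤ τ m := (hτ.mapsTo (Finset.mem_Icc.mp hm)).1
  have hmk := (Finset.mem_Icc.mp hm).2
  exact Finset.card_pair (by omega)

theorem index_mem_iff_value_mem {n k : ℕ} {π τ : ℕ → ℕ} (hτ : IsPermOf k τ) {T : Finset ℕ}
    (hT : restrict (sPart n π) T = sPart k τ) {m : ℕ} (hm : m ∈ Finset.Icc 1 n) :
    m ∈ T ↔ π m + n ∈ T := by
  have hsub (hne : (({m, π m + n} : Finset ℕ) ∩ T).Nonempty) :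
      ({m, π m + n} : Finset ℕ) ⊆ T := by
    have hmem : (({m, π m + n} : Finset ℕ) ∩ T).image (st T) ∈ sPart k τ := by
      rw [← hT]
      exact Finset.mem_filter.mpr ⟨Finset.mem_image_of_mem _ (Finset.mem_image_of_mem _ hm),
        hne.image _⟩
    have hcard := card_of_mem_sPart hτ hmem
    have hle : (({m, π m + n} : Finset ℕ)).card ≤ (({m, π m + n} : Finset ℕ) ∩ T).card :=
      Finset.card_le_two.trans (hcard ▸ Finset.card_image_le)
    exact Finset.inter_eq_left.mp (Finset.eq_of_subset_of_card_le Finset.inter_subset_left hle)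
  constructor
  · exact fun h => hsub ⟨m, by simp [h]⟩ (by simp)
  · exact fun h => hsub ⟨π m + n, by simp [h]⟩ (by simp)

theorem exists_supportSet_eq {n k : ℕ} {π τ : ℕ → ℕ} (hπ : IsPermOf n π) (hτ : IsPermOf k τ)
    {T : Finset ℕ} (hsub : T ⊆ Finset.Icc 1 (2 * n))
    (hT : restrict (sPart n π) T = sPart k τ) :
    ∃ i : Fin k → ℕ, StrictMono i ∧ (∀ j, i j ∈ Finset.Icc 1 n) ∧ supportSet n π i = T := by
  obtain ⟨c, hc⟩ : ∃ c, (T ∩ Finset.Icc 1 n).card = c := ⟨_, rfl⟩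
  let i : Fin c → ℕ := (T ∩ Finset.Icc 1 n).orderEmbOfFin hc
  have hi : StrictMono i := ((T ∩ Finset.Icc 1 n).orderEmbOfFin hc).strictMono
  have hrange (m : ℕ) : (∃ j, i j = m) ↔ m ∈ T ∩ Finset.Icc 1 n := by
    rw [← Finset.mem_coe, ← Finset.range_orderEmbOfFin _ hc, Set.mem_range]
  have himem (j : Fin c) : i j ∈ T ∩ Finset.Icc 1 n := (hrange _).mp ⟨j, rfl⟩
  have hin (j : Fin c) : i j ∈ Finset.Icc 1 n := (Finset.mem_inter.mp (himem j)).2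
  have hiT : supportSet n π i = T := by
    ext x
    constructor
    · intro hx
      rcases mem_supportSet.mp hx with ⟨j, rfl⟩ | ⟨j, rfl⟩
      · exact (Finset.mem_inter.mp (himem j)).1
      · exact (index_mem_iff_value_mem hτ hT (hin j)).mp (Finset.mem_inter.mp (himem j)).1
    · intro hx
      have hx2 := Finset.mem_Icc.mp (hsub hx)
      by_cases hxn : x ≤ n
      · exact (index_mem_supportSet_iff hπ hin hxn).mpr ((hrange x).mpr
          (Finset.mem_inter.mpr ⟨hx, Finset.mem_Icc.mpr ⟨hx2.1, hxn⟩⟩))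
      · obtain ⟨m, hm, hmx⟩ := hπ.surjOn (show x - n ∈ Set.Icc 1 n from ⟨by omega, by omega⟩)
        have hm' : m ∈ Finset.Icc 1 n := Finset.mem_Icc.mpr hm
        obtain rfl : π m + n = x := by omega
        exact (value_mem_supportSet_iff hπ hin hm').mpr ((hrange m).mpr
          (Finset.mem_inter.mpr ⟨(index_mem_iff_value_mem hτ hT hm').mpr hx, hm'⟩))
  have hck : c = k := by
    have hcard := congrArg Finset.card hT
    rwa [← hiT, restrict_supportSet hπ hi hin, sPart_eq_pairBlocks,
      card_pairBlocks (one_le_entryRank _), card_pairBlocks fun j =>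
        (hτ.mapsTo (show j.1 + 1 ∈ Set.Icc 1 k from ⟨by omega, by omega⟩)).1] at hcard
  subst hck
  exact ⟨i, hi, hin, hiT⟩

theorem restrict_supportSet_eq_sPart_iff {n k : ℕ} {π τ : ℕ → ℕ} (hπ : IsPermOf n π)
    (hτ : IsPermOf k τ) {i : Fin k → ℕ} (hi : StrictMono i)
    (hin : ∀ j, i j ∈ Finset.Icc 1 n) :
    restrict (sPart n π) (supportSet n π i) = sPart k τ ↔ IsOccurrence n k π τ i := by
  rw [restrict_supportSet hπ hi hin, sPart_eq_pairBlocks]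
  constructor
  · intro h
    have hr := pairBlocks_injective (one_le_entryRank _) (fun j =>
      (hτ.mapsTo (show j.1 + 1 ∈ Set.Icc 1 k from ⟨by omega, by omega⟩)).1) h
    refine ⟨hi, hin, fun j j' => ?_⟩
    rw [← entryRank_lt_iff (fun l => π (i l)), hr]
  · rintro ⟨-, -, h⟩
    rw [entryRank_congr h, entryRank_of_isPermOf hτ]

/-- The map sending an occurrence `i₁ < … < i_k` of `τ` in `π` to
`T = {i₁, …, i_k, π i₁ + n, …, π i_k + n}` is a bijection between occurrences of `τ` in `π`
and subsets `T ⊆ [2n]` with `s(π) ∩ T = s(τ)`; in particular the number of occurrences of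
`τ` in `π` equals the number of such subsets `T`. -/
theorem occurrences_equiv_restrict_subsets (n k : ℕ) (π τ : ℕ → ℕ)
    (hπ : IsPermOf n π) (hτ : IsPermOf k τ) :
    Set.BijOn
        (fun i : Fin k → ℕ =>
          Finset.image i Finset.univ ∪ Finset.image (fun j => π (i j) + n) Finset.univ)
        {i | IsOccurrence n k π τ i}
        {T : Finset ℕ | T ⊆ Finset.Icc 1 (2 * n) ∧ restrict (sPart n π) T = sPart k τ} ∧
    Nat.card {i : Fin k → ℕ // IsOccurrence n k π τ i} =
      Nat.card {T : Finset ℕ //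
        T ⊆ Finset.Icc 1 (2 * n) ∧ restrict (sPart n π) T = sPart k τ} := by
  have hbij : Set.BijOn (supportSet n π) {i | IsOccurrence n k π τ i}
      {T : Finset ℕ | T ⊆ Finset.Icc 1 (2 * n) ∧ restrict (sPart n π) T = sPart k τ} := by
    refine ⟨?_, (supportSet_injOn hπ).mono fun _ h => And.intro h.1 h.2.1, ?_⟩
    · intro i hi
      exact ⟨supportSet_subset_Icc hπ hi.2.1,
        (restrict_supportSet_eq_sPart_iff hπ hτ hi.1 hi.2.1).mpr hi⟩
    · rintro T ⟨hsub, hT⟩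
      obtain ⟨i, hi, hin, rfl⟩ := exists_supportSet_eq hπ hτ hsub hT
      exact ⟨i, (restrict_supportSet_eq_sPart_iff hπ hτ hi hin).mp hT, rfl⟩
  exact ⟨hbij, Nat.card_congr (Set.BijOn.equiv _ hbij)⟩
end
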